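/- arXiv:2309.11237 — 4 statements merged into one kernel-verified Lean document; each statement's English description precedes it below -/
import Mathlib

section
/- For each fixed integer n ≥ 2 there exists a constant c > 0 such that for all integers k > n, π − 2 d_GH(S^n, S^k) ≥ c/√k. -/
open Real

noncomputable section

/-- Euclidean space ℝ^d. -/
abbrev Euc (d : ℕ) : Type := EuclideanSpace ℝ (Fin d)

/-- The unit sphere S^n = {x ∈ ℝ^{n+1} : ⟨x,x⟩ = 1}. -/
def usphere (n : ℕ) : Set (Euc (n+1)) := {x | @inner ℝ _ _ x x = (1:ℝ)}

/-- The geodesic distance d(x,y) = arccos⟨x,y⟩. -/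
def geoDist {d : ℕ} (x y : Euc d) : ℝ := Real.arccos (@inner ℝ _ _ x y)

/-- A correspondence between A ⊆ ℝ^{d₁} and B ⊆ ℝ^{d₂}: a relation R ⊆ A × B whose
coordinate projections to A and B are both surjective. -/
def IsCorrespondence {d₁ d₂ : ℕ} (A : Set (Euc d₁)) (B : Set (Euc d₂))
    (R : Set (Euc d₁ × Euc d₂)) : Prop :=
  (∀ z ∈ R, z.1 ∈ A ∧ z.2 ∈ B) ∧
  (∀ a ∈ A, ∃ b ∈ B, (a, b) ∈ R) ∧
  (∀ b ∈ B, ∃ a ∈ A, (a, b) ∈ R)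

/-- The distortion of a relation, with respect to the geodesic metrics:
dis(R) = sup |d(x,x') − d(y,y')| over (x,y), (x',y') ∈ R. -/
def distortion {d₁ d₂ : ℕ} (R : Set (Euc d₁ × Euc d₂)) : ℝ :=
  sSup {t | ∃ z ∈ R, ∃ w ∈ R, t = |geoDist z.1 w.1 - geoDist z.2 w.2|}

/-- Twice the Gromov–Hausdorff distance between S^n and S^k (geodesic metrics),
via the Kalton–Ostrovskii formula: the infimum of dis(R) over all correspondences R. -/
def twoGH (n k : ℕ) : ℝ :=
  sInf {t | ∃ R : Set (Euc (n+1) × Euc (k+1)),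
    IsCorrespondence (usphere n) (usphere k) R ∧ t = distortion R}

theorem mem_usphere_iff {n : ℕ} {x : Euc (n + 1)} : x ∈ usphere n ↔ ‖x‖ = 1 := by
  rw [usphere, Set.mem_ofPred_eq, real_inner_self_eq_norm_sq,
    pow_eq_one_iff_of_nonneg (norm_nonneg x) two_ne_zero]

/-- On the unit sphere, vectors whose sum has norm at least `δ` are at geodesic distance at most
`π - δ`. -/
theorem geoDist_le_pi_sub {d : ℕ} {x y : Euc d} {δ : ℝ} (hx : ‖x‖ = 1) (hy : ‖y‖ = 1)
    (hδ : 0 ≤ δ) (hδπ : δ ≤ π) (h : δ ≤ ‖x + y‖) : geoDist x y ≤ π - δ := by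
  have h1 := norm_add_sq_real x y
  have h2 := Real.one_sub_sq_div_two_le_cos (x := δ)
  have h3 : δ ^ 2 ≤ ‖x + y‖ ^ 2 := by gcongr
  rw [hx, hy] at h1
  rw [geoDist, ← Real.arccos_cos (x := π - δ) (by linarith) (by linarith)]
  apply Real.arccos_le_arccos
  rw [Real.cos_pi_sub]
  linarith

/-- On the unit sphere, the geodesic distance dominates the chordal distance. -/
theorem le_geoDist {d : ℕ} {x y : Euc d} {δ : ℝ} (hx : ‖x‖ = 1) (hy : ‖y‖ = 1)
    (hδ : 0 ≤ δ) (hδπ : δ ≤ π) (h : δ ≤ ‖x - y‖) : δ ≤ geoDist x y := by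
  have := geoDist_le_pi_sub (y := -y) hx (by simpa using hy) hδ hδπ (by rwa [← sub_eq_add_neg])
  rw [geoDist, inner_neg_right, Real.arccos_neg] at this
  rw [geoDist]
  linarith

/-- A correspondence between spheres that is closed under simultaneous antipodes and never relates
`δ`-close points of one sphere to `δ`-almost antipodal points of the other bounds `twoGH`. -/
theorem twoGH_le_of_antipodal {n k : ℕ} {R : Set (Euc (n + 1) × Euc (k + 1))} {δ : ℝ}
    (hR : IsCorrespondence (usphere n) (usphere k) R) (hδ : 0 ≤ δ) (hδπ : δ ≤ π)
    (hneg : ∀ z ∈ R, -z ∈ R)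
    (h : ∀ z ∈ R, ∀ w ∈ R, δ ≤ ‖z.2 - w.2‖ ∨ δ ≤ ‖z.1 + w.1‖) : twoGH n k ≤ π - δ := by
  have hle : distortion R ≤ π - δ := by
    refine Real.sSup_le ?_ (by linarith)
    rintro t ⟨z, hz, w, hw, rfl⟩
    have hz1 := mem_usphere_iff.1 (hR.1 z hz).1
    have hz2 := mem_usphere_iff.1 (hR.1 z hz).2
    have hw1 := mem_usphere_iff.1 (hR.1 w hw).1
    have hw2 := mem_usphere_iff.1 (hR.1 w hw).2
    have a1 : 0 ≤ geoDist z.1 w.1 := Real.arccos_nonneg _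
    have a2 : 0 ≤ geoDist z.2 w.2 := Real.arccos_nonneg _
    have b1 : geoDist z.1 w.1 ≤ π := Real.arccos_le_pi _
    have b2 : geoDist z.2 w.2 ≤ π := Real.arccos_le_pi _
    rw [abs_sub_le_iff]
    constructor
    · rcases h z hz w hw with h | h
      · linarith [le_geoDist hz2 hw2 hδ hδπ h]
      · linarith [geoDist_le_pi_sub hz1 hw1 hδ hδπ h]
    · rcases h z hz (-w) (hneg w hw) with h | h
      · have : δ ≤ ‖z.2 + w.2‖ := by simpa using h
        linarith [geoDist_le_pi_sub hz2 hw2 hδ hδπ this]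
      · have : δ ≤ ‖z.1 - w.1‖ := by simpa [← sub_eq_add_neg] using h
        linarith [le_geoDist hz1 hw1 hδ hδπ this]
  refine le_trans (csInf_le ⟨0, ?_⟩ ⟨R, hR, rfl⟩) hle
  rintro t ⟨S, -, rfl⟩
  apply Real.sSup_nonneg
  rintro t ⟨z, -, w, -, rfl⟩
  exact abs_nonneg _

/-- A unit vector has a coordinate which is not small, up to sign. -/
theorem exists_sign_mul_coord_ge {d : ℕ} {x : Euc d} {δ : ℝ} (hx : ‖x‖ = 1)
    (hd : d * δ ^ 2 < 1) : ∃ i, ∃ s : ℝ, (s = 1 ∨ s = -1) ∧ δ ≤ s * x i := by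
  by_contra! hc
  have hs : ∀ i, x i ^ 2 ≤ δ ^ 2 := fun i => by
    have h1 := hc i 1 (Or.inl rfl)
    have h2 := hc i (-1) (Or.inr rfl)
    exact sq_le_sq' (by linarith) (by linarith)
  have h1 := EuclideanSpace.real_norm_sq_eq x
  have h2 : ∑ i, x i ^ 2 ≤ d * δ ^ 2 := by
    simpa using Finset.sum_le_sum (s := Finset.univ) fun i _ => hs i
  rw [hx] at h1
  linarith

/-- Normalising two vectors of squared norm at most `3` with a definite Cauchy–Schwarz defect
yields unit vectors separated in projective space. -/
theorem le_norm_sign_smul_normalize_add {E : Type*} [NormedAddCommGroup E] [InnerProductSpace ℝ E]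
    {u w : E} {ε s t : ℝ} (hu : u ≠ 0) (hw : w ≠ 0) (hu3 : ‖u‖ ^ 2 ≤ 3)
    (hw3 : ‖w‖ ^ 2 ≤ 3) (h : @inner ℝ _ _ u w ^ 2 + ε ^ 2 ≤ ‖u‖ ^ 2 * ‖w‖ ^ 2)
    (hs : s = 1 ∨ s = -1) (ht : t = 1 ∨ t = -1) :
    ε / 3 ≤ ‖s • (‖u‖⁻¹ • u) + t • (‖w‖⁻¹ • w)‖ := by
  have hu0 : 0 < ‖u‖ := norm_pos_iff.2 hu
  have hw0 : 0 < ‖w‖ := norm_pos_iff.2 hw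
  set c := ‖u‖⁻¹ * ‖w‖⁻¹ * @inner ℝ _ _ u w with hc
  have hc2 : c ^ 2 + (ε / 3) ^ 2 ≤ 1 := by
    have h1 : c ^ 2 * (‖u‖ ^ 2 * ‖w‖ ^ 2) = @inner ℝ _ _ u w ^ 2 := by
      rw [hc]; field_simp
    have h2 : ‖u‖ ^ 2 * ‖w‖ ^ 2 ≤ 9 := by nlinarith [sq_nonneg ‖u‖, sq_nonneg ‖w‖]
    have h3 : 0 < ‖u‖ ^ 2 * ‖w‖ ^ 2 := by positivity
    have h4 : (ε / 3) ^ 2 * (‖u‖ ^ 2 * ‖w‖ ^ 2) ≤ ε ^ 2 := by nlinarith [sq_nonneg ε]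
    by_contra! hlt
    nlinarith
  have key : ‖s • (‖u‖⁻¹ • u) + t • (‖w‖⁻¹ • w)‖ ^ 2 = 2 + 2 * (s * t) * c := by
    rw [norm_add_sq_real]
    simp only [norm_smul, inner_smul_left, inner_smul_right, norm_inv, norm_norm,
      inv_mul_cancel₀ hu0.ne', inv_mul_cancel₀ hw0.ne', hc]
    rcases hs with rfl | rfl <;> rcases ht with rfl | rfl <;> simp <;> ring
  refine le_of_abs_le (abs_le_of_sq_le_sq ?_ (norm_nonneg _))
  rw [key]
  rcases hs with rfl | rfl <;> rcases ht with rfl | rfl <;> nlinarith [sq_nonneg (1 - c), sq_nonneg (1 + c)]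

/-- A family of unit vectors extending the standard basis whose first `m ^ 2` members are separated
in projective space at scale `1 / m`; the further members are the central projections of the points
of a square grid. -/
theorem exists_projectively_separated {n m : ℕ} (hn : 2 ≤ n) (hm : 0 < m) :
    ∃ v : ℕ → Euc (n + 1), (∀ i, ‖v i‖ = 1) ∧
      (∀ i : Fin (n + 1), v i = EuclideanSpace.single i 1) ∧
      ∀ i j : ℕ, i < m ^ 2 → j < m ^ 2 → i ≠ j → ∀ s t : ℝ, (s = 1 ∨ s = -1) →
        (t = 1 ∨ t = -1) → (1 / m : ℝ) / 3 ≤ ‖s • v i + t • v j‖ := by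
  have hm0 : (0 : ℝ) < m := by exact_mod_cast hm
  have hm1 : (1 / m : ℝ) ^ 2 ≤ 1 := by
    apply pow_le_one₀ (by positivity)
    rw [div_le_one hm0]
    exact_mod_cast hm
  let e : ℕ → Euc (n + 1) := fun i => if h : i < n + 1 then EuclideanSpace.single ⟨i, h⟩ 1 else 0
  have he : ∀ i j, i ≤ n → j ≤ n → @inner ℝ _ _ (e i) (e j) = if i = j then 1 else 0 := by
    intro i j hi hj
    simp [e, hi, hj, EuclideanSpace.inner_single_left]
  let a : ℕ → ℝ := fun i => ((i % m : ℕ) : ℝ) / m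
  let b : ℕ → ℝ := fun i => ((i / m : ℕ) : ℝ) / m
  let g : ℕ → Euc (n + 1) := fun i => e 0 + a i • e 1 + b i • e 2
  have hge : ∀ i j, j ≤ n → @inner ℝ _ _ (e j) (g i) =
      (if j = 0 then 1 else 0) + a i * (if j = 1 then 1 else 0) +
        b i * (if j = 2 then 1 else 0) := by
    intro i j hj
    simp only [g, inner_add_right, inner_smul_right]
    rw [he j 0 hj (by omega), he j 1 hj (by omega), he j 2 hj hn]
  have hgg : ∀ i j, @inner ℝ _ _ (g i) (g j) = 1 + a i * a j + b i * b j := by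
    intro i j
    have : @inner ℝ _ _ (g i) (g j) = @inner ℝ _ _ (e 0) (g j) + a i * @inner ℝ _ _ (e 1) (g j) +
        b i * @inner ℝ _ _ (e 2) (g j) := by
      simp only [g, inner_add_left, inner_smul_left, RCLike.conj_to_real]
    rw [this, hge j 0 (by omega), hge j 1 (by omega), hge j 2 hn]
    simp
  have ha0 : ∀ i, 0 ≤ a i := fun i => by positivity
  have hb0 : ∀ i, 0 ≤ b i := fun i => by positivity
  have ha1 : ∀ i, a i ≤ 1 := fun i => by
    rw [div_le_one hm0]
    exact_mod_cast (Nat.mod_lt i hm).le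
  have hb1 : ∀ i, i < m ^ 2 → b i ≤ 1 := fun i hi => by
    rw [div_le_one hm0]
    exact_mod_cast (Nat.div_lt_of_lt_mul (by rwa [← sq])).le
  have hsep : ∀ i j, i ≠ j → (1 / m : ℝ) ^ 2 ≤ (a i - a j) ^ 2 + (b i - b j) ^ 2 := by
    intro i j hij
    have key : ∀ p q : ℕ, p ≠ q → (1 / m : ℝ) ^ 2 ≤ ((p : ℝ) / m - q / m) ^ 2 := by
      intro p q hpq
      rw [← sub_div, div_pow, div_pow, one_pow]
      gcongr
      have : (1 : ℤ) ≤ ((p : ℤ) - q) ^ 2 := by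
        have : ((p : ℤ) - q) ≠ 0 := by omega
        have := sq_pos_of_ne_zero this
        omega
      have h2 : (1 : ℝ) ≤ ((p : ℝ) - q) ^ 2 := by exact_mod_cast this
      exact h2
    by_cases h : i % m = j % m
    · have h' : i / m ≠ j / m := fun h' =>
        hij (by rw [← Nat.div_add_mod i m, h, h', Nat.div_add_mod])
      linarith [key _ _ h', sq_nonneg (a i - a j)]
    · linarith [key _ _ h, sq_nonneg (b i - b j)]
  let u : ℕ → Euc (n + 1) := fun i => if i ≤ n then e i else g i
  have hu_low : ∀ i, i ≤ n → u i = e i := fun i hi => if_pos hi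
  have hu_high : ∀ i, n < i → u i = g i := fun i hi => if_neg (by omega)
  have hnorm : ∀ i, 1 ≤ ‖u i‖ ^ 2 := by
    intro i
    rw [← real_inner_self_eq_norm_sq]
    rcases le_or_gt i n with hi | hi
    · rw [hu_low i hi, he i i hi hi]; simp
    · rw [hu_high i hi, hgg]; nlinarith [mul_self_nonneg (a i), mul_self_nonneg (b i)]
  have hnorm3 : ∀ i, i < m ^ 2 → ‖u i‖ ^ 2 ≤ 3 := by
    intro i him
    rw [← real_inner_self_eq_norm_sq]
    rcases le_or_gt i n with hi | hi
    · rw [hu_low i hi, he i i hi hi]; norm_num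
    · rw [hu_high i hi, hgg]; nlinarith [ha0 i, hb0 i, ha1 i, hb1 i him]
  have hne : ∀ i, u i ≠ 0 := fun i h => by have := hnorm i; norm_num [h] at this
  have hdefect : ∀ i j, i < j →
      @inner ℝ _ _ (u i) (u j) ^ 2 + (1 / m : ℝ) ^ 2 ≤ ‖u i‖ ^ 2 * ‖u j‖ ^ 2 := by
    intro i j hij
    rw [← real_inner_self_eq_norm_sq, ← real_inner_self_eq_norm_sq]
    rcases le_or_gt j n with hj | hj
    · rw [hu_low i (by omega), hu_low j hj, he _ _ (by omega) hj, he _ _ (by omega) (by omega),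
        he _ _ hj hj]
      simpa [hij.ne] using hm1
    have := hsep i j hij.ne
    rcases le_or_gt i n with hi | hi
    · rw [hu_low i hi, hu_high j hj, hge _ _ hi, he _ _ hi hi, hgg]
      have h0 : i = 0 → (1 / m : ℝ) ^ 2 ≤ a j ^ 2 + b j ^ 2 := by
        rintro rfl
        simpa [a, b] using this
      rcases Nat.lt_or_ge i 3 with h3 | h3
      · interval_cases i
        · have := h0 rfl
          norm_num at this ⊢
          nlinarith
        · norm_num at hm1 ⊢
          nlinarith [mul_self_nonneg (b j)]
        · norm_num at hm1 ⊢
          nlinarith [mul_self_nonneg (a j)]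
      · simp only [show i ≠ 0 by omega, show i ≠ 1 by omega, show i ≠ 2 by omega, if_false, if_true]
        nlinarith [mul_self_nonneg (b j), mul_self_nonneg (a j)]
    · rw [hu_high i hi, hu_high j hj, hgg, hgg, hgg]
      nlinarith [sq_nonneg (a i * b j - a j * b i)]
  refine ⟨fun i => ‖u i‖⁻¹ • u i, fun i => ?_, fun i => ?_, fun i j hi hj hij s t hs ht => ?_⟩
  · rw [norm_smul, norm_inv, norm_norm, inv_mul_cancel₀ (norm_ne_zero_iff.2 (hne i))]
  · have : u i = EuclideanSpace.single i 1 := by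
      rw [hu_low i (by omega)]; exact dif_pos i.2
    simp [this]
  · refine le_norm_sign_smul_normalize_add (hne i) (hne j) (hnorm3 i hi) (hnorm3 j hj)
      ?_ hs ht
    rcases lt_or_gt_of_ne hij with h | h
    · exact hdefect i j h
    · rw [real_inner_comm, mul_comm (‖u i‖ ^ 2)]
      exact hdefect j i h

theorem abs_coord_le_norm {d : ℕ} (x : Euc d) (i : Fin d) : |x i| ≤ ‖x‖ := by
  simpa using PiLp.norm_apply_le x i

/-- The correspondence given by unit vectors `v` extending the standard basis: a point of the large
sphere is related to `± v i` when its `i`-th coordinate is not small, and a point of the small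
sphere is related to `±` the `i`-th basis vector when its `i`-th coordinate is not small. -/
def signedCoordRel {n k : ℕ} (hnk : n < k) (δ : ℝ) (v : ℕ → Euc (n + 1)) :
    Set (Euc (n + 1) × Euc (k + 1)) :=
  {z | ‖z.1‖ = 1 ∧ ‖z.2‖ = 1 ∧ ∃ s : ℝ, (s = 1 ∨ s = -1) ∧
    ((∃ i : Fin (k + 1), z.1 = s • v i ∧ δ ≤ s * z.2 i) ∨
      ∃ i : Fin (n + 1), z.2 = s • EuclideanSpace.single (Fin.castLE (by omega) i) 1 ∧
        δ ≤ s * z.1 i)}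

theorem neg_mem_signedCoordRel {n k : ℕ} {hnk : n < k} {δ : ℝ} {v : ℕ → Euc (n + 1)}
    {z : Euc (n + 1) × Euc (k + 1)} (hz : z ∈ signedCoordRel hnk δ v) :
    -z ∈ signedCoordRel hnk δ v := by
  obtain ⟨h1, h2, s, hs, h⟩ := hz
  refine ⟨by simpa using h1, by simpa using h2, -s, by rcases hs with rfl | rfl <;> simp, ?_⟩
  rcases h with ⟨i, h3, h4⟩ | ⟨i, h3, h4⟩
  · exact Or.inl ⟨i, by simp [h3], by simpa using h4⟩
  · exact Or.inr ⟨i, by simp [h3], by simpa using h4⟩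

theorem isCorrespondence_signedCoordRel {n k : ℕ} {hnk : n < k} {δ : ℝ} {v : ℕ → Euc (n + 1)}
    (hδk : (k + 1) * δ ^ 2 < 1) (hv : ∀ i, ‖v i‖ = 1) :
    IsCorrespondence (usphere n) (usphere k) (signedCoordRel hnk δ v) := by
  have hsgn : ∀ {s : ℝ}, (s = 1 ∨ s = -1) → |s| = 1 := by rintro s (rfl | rfl) <;> simp
  refine ⟨fun z hz => ⟨mem_usphere_iff.2 hz.1, mem_usphere_iff.2 hz.2.1⟩, fun x hx => ?_,
    fun y hy => ?_⟩
  · rw [mem_usphere_iff] at hx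
    have hd : ((n + 1 : ℕ) : ℝ) * δ ^ 2 < 1 := by
      refine lt_of_le_of_lt ?_ hδk
      gcongr
      exact_mod_cast (by omega : n + 1 ≤ k + 1)
    obtain ⟨i, s, hs, h⟩ := exists_sign_mul_coord_ge hx hd
    have hy : ‖s • (EuclideanSpace.single (Fin.castLE (by omega) i) 1 : Euc (k + 1))‖ = 1 := by
      simp [norm_smul, hsgn hs]
    exact ⟨_, mem_usphere_iff.2 hy, hx, hy, s, hs, Or.inr ⟨i, rfl, h⟩⟩
  · rw [mem_usphere_iff] at hy
    obtain ⟨i, s, hs, h⟩ := exists_sign_mul_coord_ge hy (by exact_mod_cast hδk)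
    have hx : ‖s • v i‖ = 1 := by simp [norm_smul, hsgn hs, hv]
    exact ⟨_, mem_usphere_iff.2 hx, hx, hy, s, hs, Or.inl ⟨i, rfl, h⟩⟩

theorem signedCoordRel_separated {n k : ℕ} {hnk : n < k} {δ : ℝ} {v : ℕ → Euc (n + 1)}
    (hδ1 : δ ≤ 1) (hv : ∀ i, ‖v i‖ = 1)
    (hve : ∀ i : Fin (n + 1), v i = EuclideanSpace.single i 1)
    (hsep : ∀ i j : ℕ, i < k + 1 → j < k + 1 → i ≠ j → ∀ s t : ℝ, (s = 1 ∨ s = -1) →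
        (t = 1 ∨ t = -1) → δ ≤ ‖s • v i + t • v j‖)
    {z w : Euc (n + 1) × Euc (k + 1)} (hz : z ∈ signedCoordRel hnk δ v)
    (hw : w ∈ signedCoordRel hnk δ v) : δ ≤ ‖z.2 - w.2‖ ∨ δ ≤ ‖z.1 + w.1‖ := by
  have mixed : ∀ {x x' : Euc (n + 1)} {y y' : Euc (k + 1)} {s t : ℝ} {i : Fin (k + 1)}
      {j : Fin (n + 1)}, (s = 1 ∨ s = -1) → (t = 1 ∨ t = -1) → x = s • v i → δ ≤ s * y i →
      y' = t • EuclideanSpace.single (Fin.castLE (by omega) j) 1 → δ ≤ t * x' j →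
      δ ≤ ‖y - y'‖ ∨ δ ≤ ‖x + x'‖ := by
    intro x x' y y' s t i j hs ht hx hy hy' hx'
    have hcy := abs_coord_le_norm (y - y') i
    by_cases hij : i = Fin.castLE (by omega) j
    · subst hij
      have hcx := abs_coord_le_norm (x + x') j
      have hx2 : x = s • EuclideanSpace.single j 1 := by rw [hx, ← hve j]; rfl
      simp only [hx2, hy', PiLp.sub_apply, PiLp.add_apply, PiLp.smul_apply, smul_eq_mul,
        PiLp.single_apply, if_true, mul_one] at hcx hcy
      rw [← hx2] at hcx
      rw [← hy'] at hcy
      rw [abs_le] at hcx hcy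
      rcases hs with rfl | rfl <;> rcases ht with rfl | rfl
      · right; linarith
      · left; linarith
      · left; linarith
      · right; linarith
    · left
      have h0 : y' i = 0 := by simp [hy', hij]
      rw [PiLp.sub_apply, h0, sub_zero, abs_le] at hcy
      rcases hs with rfl | rfl <;> linarith
  obtain ⟨-, -, s, hs, h⟩ := hz
  obtain ⟨-, -, t, ht, h'⟩ := hw
  rcases h with ⟨i, h1, h2⟩ | ⟨i, h1, h2⟩ <;> rcases h' with ⟨j, h3, h4⟩ | ⟨j, h3, h4⟩
  · by_cases hij : i = j
    · subst hij
      have hcy := abs_coord_le_norm (z.2 - w.2) i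
      rw [PiLp.sub_apply, abs_le] at hcy
      have h2v : ∀ r : ℝ, (r = 1 ∨ r = -1) → ‖r • v i + r • v i‖ = 2 := by
        intro r hr
        rw [← two_smul ℝ, norm_smul, norm_smul, hv]
        rcases hr with rfl | rfl <;> simp
      have h2s := h2v s hs
      rcases hs with rfl | rfl <;> rcases ht with rfl | rfl
      · right; rw [h1, h3]; linarith
      · left; linarith
      · left; linarith
      · right; rw [h1, h3]; linarith
    · right
      rw [h1, h3]
      exact hsep i j i.2 j.2 (fun h => hij (Fin.ext h)) s t hs ht
  · exact mixed hs ht h1 h2 h3 h4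
  · rw [norm_sub_rev, add_comm z.1]
    exact mixed ht hs h3 h4 h1 h2
  · have hcy := abs_coord_le_norm (z.2 - w.2) (Fin.castLE (by omega) i)
    have hcx := abs_coord_le_norm (z.1 + w.1) i
    rw [abs_le] at hcx hcy
    simp only [PiLp.sub_apply, PiLp.add_apply] at hcx hcy
    by_cases hij : i = j
    · subst hij
      have e1 : z.2 (Fin.castLE (by omega) i) = s := by simp [h1]
      have e2 : w.2 (Fin.castLE (by omega) i) = t := by simp [h3]
      rw [e1, e2] at hcy
      rcases hs with rfl | rfl <;> rcases ht with rfl | rfl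
      · right; linarith
      · left; linarith
      · left; linarith
      · right; linarith
    · left
      have e1 : z.2 (Fin.castLE (by omega) i) = s := by simp [h1]
      have e2 : w.2 (Fin.castLE (by omega) i) = 0 := by simp [h3, hij]
      rw [e1, e2] at hcy
      rcases hs with rfl | rfl <;> linarith

/-- For each fixed n ≥ 2 there is a constant c > 0 such that for all k > n,
π − 2 d_GH(S^n, S^k) ≥ c/√k. -/
theorem two_dGH_gap_asymptotic (n : ℕ) (hn : 2 ≤ n) :
    ∃ c : ℝ, 0 < c ∧ ∀ k : ℕ, n < k → c / Real.sqrt k ≤ π - twoGH n k := by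
  refine ⟨1 / 6, by norm_num, fun k hnk => ?_⟩
  have hk1 : (1 : ℝ) ≤ k := by exact_mod_cast (by omega : 1 ≤ k)
  have hs1 : 1 ≤ √(k : ℝ) := Real.one_le_sqrt.2 hk1
  have hsq : √(k : ℝ) ^ 2 = k := Real.sq_sqrt (by linarith)
  set δ : ℝ := 1 / 6 / √(k : ℝ) with hδdef
  have hδ : 0 ≤ δ := by positivity
  have hδ1 : δ ≤ 1 := by
    rw [hδdef, div_le_one (by linarith)]
    linarith
  have hδk : (k + 1) * δ ^ 2 < 1 := by
    rw [hδdef, div_pow, hsq, mul_div_assoc', div_lt_one (by linarith)]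
    linarith
  have hm2 : k + 1 ≤ (Nat.sqrt k + 1) ^ 2 := Nat.succ_le_of_lt (Nat.lt_succ_sqrt' k)
  have hδm : δ ≤ 1 / ((Nat.sqrt k + 1 : ℕ) : ℝ) / 3 := by
    have : (Nat.sqrt k : ℝ) ≤ √(k : ℝ) := Real.nat_sqrt_le_real_sqrt
    rw [hδdef, div_div, div_div]
    apply one_div_le_one_div_of_le (by positivity)
    push_cast
    linarith
  obtain ⟨v, hv, hve, hsep⟩ := exists_projectively_separated (m := Nat.sqrt k + 1) hn (Nat.succ_pos _)
  have := twoGH_le_of_antipodal (δ := δ)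
    (isCorrespondence_signedCoordRel (hnk := hnk) hδk hv) hδ
    (by linarith [Real.pi_gt_three]) (fun _ => neg_mem_signedCoordRel)
    (fun z hz w hw => signedCoordRel_separated hδ1 hv hve
      (fun i j hi hj hij s t hs ht => hδm.trans
        (hsep i j (by omega) (by omega) hij s t hs ht)) hz hw)
  linarith
end
end

section
/- Let P = {±p_1, …, ±p_m} ⊆ S^n and Q = {±q_1, …, ±q_m} ⊆ S^k be finite antipodal sets of equal size, with Voronoi diagrams {±F_1, …, ±F_m} in S^n (where ±F_i is the Voronoi cell of ±p_i) and {±G_1, …, ±G_m} in S^k (where ±G_i is the Voronoi cell of ±q_i). Define the correspondence R_{P,Q} = { ±(p_i, q) : i ∈ [m], q ∈ G_i } ∪ { ±(p, q_i) : i ∈ [m], p ∈ F_i } ⊆ S^n × S^k. Then dis(R_{P,Q}) ≤ max{ vdiam_{S^n}(P), π − sep_{S^n}(P), vdiam_{S^k}(Q), π − sep_{S^k}(Q) }. -/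
open Real

noncomputable section

/-- The separation of a set P: the infimum of geodesic distances between distinct points. -/
def sepS {d : ℕ} (P : Set (Euc d)) : ℝ :=
  sInf {t | ∃ p ∈ P, ∃ q ∈ P, p ≠ q ∧ t = geoDist p q}

/-- The diameter of a set with respect to the geodesic metric. -/
def geoDiam {d : ℕ} (A : Set (Euc d)) : ℝ :=
  sSup {t | ∃ x ∈ A, ∃ y ∈ A, t = geoDist x y}

/-- The Voronoi cell of p with respect to the point set P, within the ambient set S:
all x ∈ S at least as close (geodesically) to p as to every point of P. -/
def vcell {d : ℕ} (S P : Set (Euc d)) (p : Euc d) : Set (Euc d) :=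
  {x ∈ S | ∀ q ∈ P, geoDist x p ≤ geoDist x q}

/-- The Voronoi diameter of the point set P in the ambient set S:
the supremum of the diameters of the Voronoi cells of the points of P. -/
def vdiam {d : ℕ} (S P : Set (Euc d)) : ℝ :=
  sSup {t | ∃ p ∈ P, t = geoDiam (vcell S P p)}

theorem geoDist_nonneg {d : ℕ} (x y : Euc d) : 0 ≤ geoDist x y := Real.arccos_nonneg _

theorem geoDist_le_pi {d : ℕ} (x y : Euc d) : geoDist x y ≤ π := Real.arccos_le_pi _

theorem geoDist_comm {d : ℕ} (x y : Euc d) : geoDist x y = geoDist y x := by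
  simp only [geoDist, real_inner_comm]

theorem geoDist_neg_left {d : ℕ} (x y : Euc d) : geoDist (-x) y = π - geoDist x y := by
  simp only [geoDist, inner_neg_left, Real.arccos_neg]

theorem geoDist_neg_right {d : ℕ} (x y : Euc d) : geoDist x (-y) = π - geoDist x y := by
  simp only [geoDist, inner_neg_right, Real.arccos_neg]

theorem geoDist_self {n : ℕ} {x : Euc (n + 1)} (hx : x ∈ usphere n) : geoDist x x = 0 := by
  rw [geoDist, show inner ℝ x x = (1 : ℝ) from hx, Real.arccos_one]

theorem norm_eq_one_of_mem_usphere {n : ℕ} {x : Euc (n + 1)} (hx : x ∈ usphere n) : ‖x‖ = 1 := by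
  have h : inner ℝ x x = (1 : ℝ) := hx
  rw [real_inner_self_eq_norm_sq] at h
  nlinarith [norm_nonneg x]

theorem neg_mem_usphere {n : ℕ} {x : Euc (n + 1)} (hx : x ∈ usphere n) : -x ∈ usphere n := by
  simpa [usphere] using hx

theorem geoDist_eq_angle {n : ℕ} {x y : Euc (n + 1)} (hx : x ∈ usphere n) (hy : y ∈ usphere n) :
    geoDist x y = InnerProductGeometry.angle x y := by
  simp [geoDist, InnerProductGeometry.angle, norm_eq_one_of_mem_usphere hx,
    norm_eq_one_of_mem_usphere hy]

theorem geoDist_triangle {n : ℕ} {x y z : Euc (n + 1)} (hx : x ∈ usphere n) (hy : y ∈ usphere n)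
    (hz : z ∈ usphere n) : geoDist x z ≤ geoDist x y + geoDist y z := by
  rw [geoDist_eq_angle hx hy, geoDist_eq_angle hx hz, geoDist_eq_angle hy hz]
  exact InnerProductGeometry.angle_le_angle_add_angle x y z

theorem sepS_le_geoDist {d : ℕ} {P : Set (Euc d)} {a b : Euc d} (ha : a ∈ P) (hb : b ∈ P)
    (hab : a ≠ b) : sepS P ≤ geoDist a b := by
  refine csInf_le ⟨0, ?_⟩ ⟨a, ha, b, hb, hab, rfl⟩
  rintro _ ⟨x, _, y, _, _, rfl⟩
  exact geoDist_nonneg x y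

theorem geoDiam_le_pi {d : ℕ} (A : Set (Euc d)) : geoDiam A ≤ π := by
  refine Real.sSup_le ?_ Real.pi_nonneg
  rintro _ ⟨x, _, y, _, rfl⟩
  exact geoDist_le_pi x y

theorem geoDist_le_geoDiam {d : ℕ} {A : Set (Euc d)} {x y : Euc d} (hx : x ∈ A) (hy : y ∈ A) :
    geoDist x y ≤ geoDiam A := by
  refine le_csSup ⟨π, ?_⟩ ⟨x, hx, y, hy, rfl⟩
  rintro _ ⟨x, _, y, _, rfl⟩
  exact geoDist_le_pi x y

theorem geoDist_le_vdiam {d : ℕ} {S P : Set (Euc d)} {a x y : Euc d} (ha : a ∈ P)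
    (hx : x ∈ vcell S P a) (hy : y ∈ vcell S P a) : geoDist x y ≤ vdiam S P := by
  refine (geoDist_le_geoDiam hx hy).trans (le_csSup ⟨π, ?_⟩ ⟨a, ha, rfl⟩)
  rintro _ ⟨b, _, rfl⟩
  exact geoDiam_le_pi _

theorem vdiam_nonneg {d : ℕ} (S P : Set (Euc d)) : 0 ≤ vdiam S P := by
  refine Real.sSup_nonneg ?_
  rintro _ ⟨a, _, rfl⟩
  refine Real.sSup_nonneg ?_
  rintro _ ⟨x, _, y, _, rfl⟩
  exact geoDist_nonneg x y

theorem mem_vcell_self {n : ℕ} {P : Set (Euc (n + 1))} {a : Euc (n + 1)} (ha : a ∈ usphere n) :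
    a ∈ vcell (usphere n) P a :=
  ⟨ha, fun b _ => by rw [geoDist_self ha]; exact geoDist_nonneg a b⟩

theorem sepS_le_two_mul_geoDist {n : ℕ} {P : Set (Euc (n + 1))} {a b x : Euc (n + 1)}
    (haS : a ∈ usphere n) (hbS : b ∈ usphere n) (ha : a ∈ P) (hb : b ∈ P) (hab : a ≠ b)
    (hx : x ∈ vcell (usphere n) P b) : sepS P ≤ 2 * geoDist x a := by
  have h₁ := sepS_le_geoDist ha hb hab
  have h₂ := geoDist_triangle haS hx.1 hbS
  have h₃ := hx.2 a ha
  rw [geoDist_comm a x] at h₂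
  linarith

/-- The part `{(pᵢ, y) : y ∈ Gᵢ}` of the correspondence has the claimed distortion. -/
theorem abs_geoDist_sub_le_of_mem_cells {d k m : ℕ} {p : Fin m → Euc d} {q : Fin m → Euc (k + 1)}
    {P : Set (Euc d)} {Q : Set (Euc (k + 1))} (hp : ∀ i, geoDist (p i) (p i) = 0)
    (hpinj : ∀ i j, p i = p j → i = j) (hpanti : ∀ i j, p i ≠ -p j)
    (hpP : ∀ i, p i ∈ P) (hnP : ∀ i, -p i ∈ P) (hqQ : ∀ i, q i ∈ Q)
    {i j : Fin m} {y y' : Euc (k + 1)} (hy : y ∈ vcell (usphere k) Q (q i))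
    (hy' : y' ∈ vcell (usphere k) Q (q j)) :
    |geoDist (p i) (p j) - geoDist y y'| ≤ max (π - sepS P) (vdiam (usphere k) Q) := by
  have h₀ := geoDist_nonneg y y'
  by_cases hij : i = j
  · subst hij
    rw [hp i, zero_sub, abs_neg, abs_of_nonneg h₀]
    exact le_max_of_le_right (geoDist_le_vdiam (hqQ i) hy hy')
  · have h₁ := sepS_le_geoDist (hpP i) (hpP j) fun h => hij (hpinj i j h)
    have h₂ := sepS_le_geoDist (hpP i) (hnP j) (hpanti i j)
    rw [geoDist_neg_right] at h₂
    have h₃ := geoDist_le_pi y y'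
    refine le_max_of_le_left (abs_le.2 ⟨?_, ?_⟩) <;> linarith

/-- The distortion between a pair `(pᵢ, y)` with `y ∈ Gᵢ` and a pair `(x, qⱼ)` with `x ∈ Fⱼ`. -/
theorem abs_geoDist_sub_le_of_mem_cell_of_mem_cell {n k m : ℕ}
    {p : Fin m → Euc (n + 1)} {q : Fin m → Euc (k + 1)}
    {P : Set (Euc (n + 1))} {Q : Set (Euc (k + 1))}
    (hp : ∀ i, p i ∈ usphere n) (hq : ∀ i, q i ∈ usphere k)
    (hpinj : ∀ i j, p i = p j → i = j) (hpanti : ∀ i j, p i ≠ -p j)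
    (hqinj : ∀ i j, q i = q j → i = j) (hqanti : ∀ i j, q i ≠ -q j)
    (hpP : ∀ i, p i ∈ P) (hnP : ∀ i, -p i ∈ P) (hqQ : ∀ i, q i ∈ Q) (hnQ : ∀ i, -q i ∈ Q)
    {i j : Fin m} {x : Euc (n + 1)} {y : Euc (k + 1)}
    (hy : y ∈ vcell (usphere k) Q (q i)) (hx : x ∈ vcell (usphere n) P (p j)) :
    |geoDist (p i) x - geoDist y (q j)| ≤ max (max (vdiam (usphere n) P) (π - sepS P))
      (max (vdiam (usphere k) Q) (π - sepS Q)) := by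
  by_cases hij : i = j
  · subst hij
    have h₁ := geoDist_le_vdiam (hpP i) (mem_vcell_self (hp i)) hx
    have h₂ := geoDist_le_vdiam (hqQ i) hy (mem_vcell_self (hq i))
    have h₃ := geoDist_nonneg (p i) x
    have h₄ := geoDist_nonneg y (q i)
    refine le_trans ?_ (max_le_max (le_max_left _ (π - sepS P)) (le_max_left _ (π - sepS Q)))
    have h₅ := le_max_left (vdiam (usphere n) P) (vdiam (usphere k) Q)
    have h₆ := le_max_right (vdiam (usphere n) P) (vdiam (usphere k) Q)
    refine abs_le.2 ⟨?_, ?_⟩ <;> linarith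
  · have h₁ := sepS_le_two_mul_geoDist (hp i) (hp j) (hpP i) (hpP j)
      (fun h => hij (hpinj i j h)) hx
    have h₂ := sepS_le_two_mul_geoDist (neg_mem_usphere (hp i)) (hp j) (hnP i) (hpP j)
      (fun h => hpanti j i h.symm) hx
    have h₃ := sepS_le_two_mul_geoDist (hq j) (hq i) (hqQ j) (hqQ i)
      (fun h => hij (hqinj j i h).symm) hy
    have h₄ := sepS_le_two_mul_geoDist (neg_mem_usphere (hq j)) (hq i) (hnQ j) (hqQ i)
      (fun h => hqanti i j h.symm) hy
    rw [geoDist_neg_right] at h₂ h₄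
    rw [geoDist_comm (p i) x]
    refine le_trans ?_ (max_le_max (le_max_right _ (π - sepS P)) (le_max_right _ (π - sepS Q)))
    have h₅ := le_max_left (π - sepS P) (π - sepS Q)
    have h₆ := le_max_right (π - sepS P) (π - sepS Q)
    refine abs_le.2 ⟨?_, ?_⟩ <;> linarith

/-- Theorem on correspondences induced by antipodal sets: if P = {±p₁,…,±p_m} ⊆ S^n and
Q = {±q₁,…,±q_m} ⊆ S^k are antipodal sets of equal size, with Voronoi cells ±F_i of ±p_i
and ±G_i of ±q_i, then the correspondence
R = {±(p_i, q) : q ∈ G_i} ∪ {±(p, q_i) : p ∈ F_i}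
has distortion at most max{vdiam(P), π − sep(P), vdiam(Q), π − sep(Q)}. -/
theorem distortion_induced_correspondence (n k m : ℕ)
    (hn : 1 ≤ n) (hk : 1 ≤ k) (hm : 1 ≤ m)
    (p : Fin m → Euc (n+1)) (q : Fin m → Euc (k+1))
    (hp : ∀ i, p i ∈ usphere n) (hq : ∀ i, q i ∈ usphere k)
    (hpinj : ∀ i j, p i = p j → i = j) (hpanti : ∀ i j, p i ≠ - p j)
    (hqinj : ∀ i j, q i = q j → i = j) (hqanti : ∀ i j, q i ≠ - q j)
    (P : Set (Euc (n+1))) (hP : P = Set.range p ∪ Set.range (fun i => - p i))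
    (Q : Set (Euc (k+1))) (hQ : Q = Set.range q ∪ Set.range (fun i => - q i))
    (R : Set (Euc (n+1) × Euc (k+1)))
    (hR : R = {z | ∃ i : Fin m,
      (z.1 = p i ∧ z.2 ∈ vcell (usphere k) Q (q i)) ∨
      (z.1 = - p i ∧ - z.2 ∈ vcell (usphere k) Q (q i)) ∨
      (z.2 = q i ∧ z.1 ∈ vcell (usphere n) P (p i)) ∨
      (z.2 = - q i ∧ - z.1 ∈ vcell (usphere n) P (p i))}) :
    distortion R ≤ max (max (vdiam (usphere n) P) (π - sepS P))
      (max (vdiam (usphere k) Q) (π - sepS Q)) := by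
  have hpP : ∀ i, p i ∈ P := fun i => hP ▸ Or.inl ⟨i, rfl⟩
  have hnP : ∀ i, -p i ∈ P := fun i => hP ▸ Or.inr ⟨i, rfl⟩
  have hqQ : ∀ i, q i ∈ Q := fun i => hQ ▸ Or.inl ⟨i, rfl⟩
  have hnQ : ∀ i, -q i ∈ Q := fun i => hQ ▸ Or.inr ⟨i, rfl⟩
  set M := max (max (vdiam (usphere n) P) (π - sepS P))
    (max (vdiam (usphere k) Q) (π - sepS Q))
  have hvP : vdiam (usphere n) P ≤ M := (le_max_left _ _).trans (le_max_left _ _)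
  have hsP : π - sepS P ≤ M := (le_max_right _ _).trans (le_max_left _ _)
  have hvQ : vdiam (usphere k) Q ≤ M := (le_max_left _ _).trans (le_max_right _ _)
  have hsQ : π - sepS Q ≤ M := (le_max_right _ _).trans (le_max_right _ _)
  let T : Set (Euc (n + 1) × Euc (k + 1)) := {z | ∃ i : Fin m,
    (z.1 = p i ∧ z.2 ∈ vcell (usphere k) Q (q i)) ∨
    (z.2 = q i ∧ z.1 ∈ vcell (usphere n) P (p i))}
  have hT : ∀ z ∈ T, ∀ w ∈ T, |geoDist z.1 w.1 - geoDist z.2 w.2| ≤ M := by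
    rintro ⟨x, y⟩ ⟨i, ⟨h, hy⟩ | ⟨h, hx⟩⟩ ⟨x', y'⟩ ⟨j, ⟨h', hy'⟩ | ⟨h', hx'⟩⟩ <;>
      dsimp only at * <;> subst h h'
    · exact (abs_geoDist_sub_le_of_mem_cells (fun i => geoDist_self (hp i)) hpinj hpanti hpP hnP
        hqQ hy hy').trans (max_le hsP hvQ)
    · exact abs_geoDist_sub_le_of_mem_cell_of_mem_cell hp hq hpinj hpanti hqinj hqanti hpP hnP
        hqQ hnQ hy hx'
    · rw [geoDist_comm x, geoDist_comm (q i)]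
      exact abs_geoDist_sub_le_of_mem_cell_of_mem_cell hp hq hpinj hpanti hqinj hqanti hpP hnP
        hqQ hnQ hy' hx
    · rw [abs_sub_comm]
      exact (abs_geoDist_sub_le_of_mem_cells (fun i => geoDist_self (hq i)) hqinj hqanti hqQ hnQ
        hpP hx hx').trans (max_le hsQ hvP)
  have hRT : ∀ z ∈ R, z ∈ T ∨ -z ∈ T := by
    rw [hR]
    rintro z ⟨i, h | ⟨h, h'⟩ | h | ⟨h, h'⟩⟩
    · exact Or.inl ⟨i, Or.inl h⟩
    · exact Or.inr ⟨i, Or.inl ⟨by simp [h], h'⟩⟩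
    · exact Or.inl ⟨i, Or.inr h⟩
    · exact Or.inr ⟨i, Or.inr ⟨by simp [h], h'⟩⟩
  refine Real.sSup_le ?_ ((vdiam_nonneg _ _).trans hvP)
  rintro _ ⟨z, hz, w, hw, rfl⟩
  rcases hRT z hz with hz | hz <;> rcases hRT w hw with hw | hw <;>
    simpa only [Prod.fst_neg, Prod.snd_neg, geoDist_neg_left, geoDist_neg_right,
      sub_sub_sub_cancel_left, sub_sub_cancel, abs_sub_comm] using hT _ hz _ hw
end
end

section
/- For every integer k ≥ 3, arccos(−(k−1)/(k+1)) ≤ (k−1)π/k, with equality when k = 3. -/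
open Real

theorem sub_one_div_add_one_le_cos_pi_div {k : ℕ} (hk : 3 ≤ k) :
    ((k : ℝ) - 1) / (k + 1) ≤ cos (π / k) := by
  rcases hk.eq_or_lt with rfl | hk
  · norm_num [cos_pi_div_three]
  · have hk4 : (4 : ℝ) ≤ k := by exact_mod_cast hk
    have hpi : π ^ 2 ≤ 10 := by nlinarith [pi_pos, pi_lt_d2]
    refine le_trans ?_ one_sub_sq_div_two_le_cos
    have hsq : (π / k) ^ 2 / 2 ≤ 2 / ((k : ℝ) + 1) := by
      rw [div_pow, div_div, div_le_div_iff₀ (by positivity) (by positivity)]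
      nlinarith
    have hfrac : ((k : ℝ) - 1) / (k + 1) = 1 - 2 / (k + 1) := by
      field_simp
      ring
    linarith

/-- For every integer k ≥ 3, arccos(−(k−1)/(k+1)) ≤ (k−1)π/k, with equality when k = 3. -/
theorem arccos_le (k : ℕ) (hk : 3 ≤ k) :
    Real.arccos (-((k : ℝ) - 1) / ((k : ℝ) + 1)) ≤ ((k : ℝ) - 1) * π / k ∧
    (k = 3 → Real.arccos (-((k : ℝ) - 1) / ((k : ℝ) + 1)) = ((k : ℝ) - 1) * π / k) := by
  have hk0 : (0 : ℝ) < k := by exact_mod_cast (by lia : 0 < k)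
  have hangle : ((k : ℝ) - 1) * π / k = π - π / k := by
    field_simp
  rw [neg_div, arccos_neg, hangle]
  constructor
  · have hpi : π / k ≤ π :=
      div_le_self pi_pos.le (by exact_mod_cast (by lia : 1 ≤ k))
    have h := arccos_le_arccos (sub_one_div_add_one_le_cos_pi_div hk)
    rw [arccos_cos (by positivity) hpi] at h
    linarith
  · rintro rfl
    have hcos : (((3 : ℕ) : ℝ) - 1) / ((3 : ℕ) + 1) = cos (π / (3 : ℕ)) := by
      norm_num [cos_pi_div_three]
    rw [hcos, arccos_cos (by positivity) (div_le_self pi_pos.le (by norm_num))]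
end

section
/- Let k ≥ 3 be odd and let x ∈ 𝒢_1 ∩ 𝒢_{k+1} (so that x_1 = −x_{k+1}). Then f_{k+1}(x) − f_1(x) = (k−1)π/k. -/
open Real

noncomputable section

/-- The circle distance between two angles θ, φ ∈ ℝ: the representative of
|θ − φ| modulo 2π lying in [0, π] (the geodesic distance in S¹ between
(cos θ, sin θ) and (cos φ, sin φ)). -/
def circleDist (θ φ : ℝ) : ℝ := Real.arccos (Real.cos (θ - φ))

/-- The coordinate index (0-based) of the cell 𝒢_m: the 1-based index m reduced
modulo k+1 to {1,…,k+1}, shifted to 0-based. -/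
def gIdx (k m : ℕ) : Fin (k+1) := ⟨(m - 1) % (k + 1), Nat.mod_lt _ (Nat.succ_pos k)⟩

/-- The sign of the cell 𝒢_m: writing m − 1 = q(k+1) + r, the sign is (−1)^{r+q}.
For 1 ≤ m ≤ k+1 this is (−1)^{m+1}, and 𝒢_{m+k+1} = −𝒢_m. -/
def gSign (k m : ℕ) : ℝ := (-1) ^ ((m - 1) % (k + 1) + (m - 1) / (k + 1))

/-- The cell 𝒢_m = (−1)^{m+1} G_{m mod (k+1)} ⊆ S^k, where G_i is the Voronoi cell
of the standard basis vector e_i with respect to {±e₁,…,±e_{k+1}}: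
x ∈ 𝒢_m iff x ∈ S^k and the signed coordinate gSign·x_{gIdx} dominates all |x_j|. -/
def Gcal (k m : ℕ) : Set (Euc (k+1)) :=
  {x | x ∈ usphere k ∧ ∀ j, |x j| ≤ gSign k m * x (gIdx k m)}

/-- The function f_m : 𝒢_m → ℝ (an angle parametrizing S¹),
f_m(x) = (m−1)π/(k+1) + (π/(2k(k+1)))·(x_1 + ⋯ + x_{m−1} − x_{m+1} − ⋯ − x_{k+1})/x_m,
coordinate subscripts taken modulo k+1 (as angles, i.e. modulo 2π, for m > k+1). -/
def fFun (k m : ℕ) (x : Euc (k+1)) : ℝ :=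
  ((m : ℝ) - 1) * π / ((k : ℝ) + 1) + π / (2 * (k : ℝ) * ((k : ℝ) + 1)) *
    ((∑ j : Fin (k+1),
        (if (j : ℕ) < (m - 1) % (k + 1) then (1:ℝ)
         else if (j : ℕ) = (m - 1) % (k + 1) then 0 else -1) * x j) / x (gIdx k m))

/-- A point of the sphere has nonzero dominant coordinate in each cell containing it. -/
theorem Gcal_apply_gIdx_ne_zero {k m : ℕ} {x : Euc (k+1)} (hx : x ∈ Gcal k m) :
    x (gIdx k m) ≠ 0 := by
  obtain ⟨hs, hdom⟩ := hx
  intro h0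
  have hzero : x = 0 := by
    ext j
    simpa [h0] using hdom j
  simp [usphere, hzero] at hs

theorem fFun_one (k : ℕ) (x : Euc (k+1)) :
    fFun k 1 x = π / (2 * (k : ℝ) * ((k : ℝ) + 1)) * ((x 0 - ∑ j, x j) / x 0) := by
  have hidx : gIdx k 1 = 0 := by simp [gIdx]
  simp [fFun, hidx, Fin.sum_univ_succ]

theorem fFun_add_one (k : ℕ) (x : Euc (k+1)) :
    fFun k (k+1) x = (k : ℝ) * π / ((k : ℝ) + 1) + π / (2 * (k : ℝ) * ((k : ℝ) + 1)) *
      ((∑ j, x j - x (Fin.last k)) / x (Fin.last k)) := by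
  have hidx : gIdx k (k+1) = Fin.last k := by
    ext
    simp [gIdx]
  simp [fFun, hidx, Fin.sum_univ_castSucc]

theorem apply_last_eq_neg_apply_zero {k : ℕ} (hodd : Odd k) {x : Euc (k+1)}
    (hx1 : x ∈ Gcal k 1) (hx2 : x ∈ Gcal k (k+1)) : x (Fin.last k) = -x 0 := by
  have hidx1 : gIdx k 1 = 0 := by simp [gIdx]
  have hidx2 : gIdx k (k+1) = Fin.last k := by
    ext
    simp [gIdx]
  have hsign1 : gSign k 1 = 1 := by simp [gSign]
  have hsign2 : gSign k (k+1) = -1 := by simp [gSign, Nat.div_eq_of_lt k.lt_succ_self, hodd.neg_one_pow]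
  have h1 := hx1.2 (Fin.last k)
  have h2 := hx2.2 0
  rw [hidx1, hsign1] at h1
  rw [hidx2, hsign2] at h2
  linarith [neg_abs_le (x (Fin.last k)), le_abs_self (x 0)]

/-- Let k ≥ 3 be odd and x ∈ 𝒢_1 ∩ 𝒢_{k+1}. Then f_{k+1}(x) − f_1(x) = (k−1)π/k. -/
theorem fFun_max_dist (k : ℕ) (hk : 3 ≤ k) (hodd : Odd k)
    (x : Euc (k+1)) (hx1 : x ∈ Gcal k 1) (hx2 : x ∈ Gcal k (k+1)) :
    fFun k (k+1) x - fFun k 1 x = ((k : ℝ) - 1) * π / k := by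
  have h0 : x 0 ≠ 0 := by simpa [gIdx] using Gcal_apply_gIdx_ne_zero hx1
  have hk0 : (k : ℝ) ≠ 0 := by
    norm_cast
    lia
  have hk1 : (k : ℝ) + 1 ≠ 0 := by positivity
  rw [fFun_one, fFun_add_one, apply_last_eq_neg_apply_zero hodd hx1 hx2]
  field_simp
  ring
end
end
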